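/- Let (R,m,k) be a noetherian local ring with t = depth R ≥ 3. If (Ω^i_R k)* ≅ Ω^i_R k for some integer 2 ≤ i < t, then R is regular and t = 2i − 1. -/

import Mathlib

open CategoryTheory IsLocalRing

noncomputable def ExtMod (R : Type) [CommRing R] (M N : Type) [AddCommGroup M] [Module R M]
    [AddCommGroup N] [Module R N] (i : ℕ) : ModuleCat R :=
  ((Ext R (ModuleCat.{0} R) i).obj (Opposite.op (ModuleCat.of R M))).obj (ModuleCat.of R N)

noncomputable def mgrade (R : Type) [CommRing R] (M : Type) [AddCommGroup M] [Module R M] : ℕ :=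
  sInf {i | Nontrivial (ExtMod R M R i)}

def IsTotallySelfDual (R : Type) [CommRing R] (M : Type) [AddCommGroup M] [Module R M] : Prop :=
  Nontrivial M ∧ Nonempty (ExtMod R M R (mgrade R M) ≃ₗ[R] M) ∧
    ∀ i, i ≠ mgrade R M → Subsingleton (ExtMod R M R i)

/-- A minimal free resolution of `M` over a local ring `R`: a resolution by finite free
modules all of whose differentials (and the augmentation) have image inside `𝔪`-times
the target (resp. have kernel inside `𝔪 F₀`). -/
structure MinFreeRes (R : Type) [CommRing R] [IsLocalRing R]
    (M : Type) [AddCommGroup M] [Module R M] where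
  F : ℕ → ModuleCat.{0} R
  free : ∀ n, Module.Free R (F n)
  fin : ∀ n, Module.Finite R (F n)
  d : ∀ n, F (n + 1) →ₗ[R] F n
  aug : F 0 →ₗ[R] M
  aug_surj : Function.Surjective aug
  exact_aug : LinearMap.ker aug = LinearMap.range (d 0)
  exact : ∀ n, LinearMap.ker (d n) = LinearMap.range (d (n + 1))
  minimal : ∀ n, LinearMap.range (d n) ≤ (maximalIdeal R) • (⊤ : Submodule R (F n))

namespace MinFreeRes

variable {R : Type} [CommRing R] [IsLocalRing R]
  {M : Type} [AddCommGroup M] [Module R M]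

/-- The `n`-th syzygy of `M` with respect to a minimal free resolution:
`Ω⁰ M = M` and `Ωⁿ⁺¹ M = Im(dₙ) = Ker(dₙ₋₁)`. -/
noncomputable def Syz (C : MinFreeRes R M) : ℕ → ModuleCat.{0} R
  | 0 => ModuleCat.of R M
  | n + 1 => ModuleCat.of R (LinearMap.range (C.d n))

/-- A minimal free resolution is self-dual if it is bounded, of length `r`, and is
isomorphic (as a complex) to its `R`-dual complex with reversed indexing. -/
def SelfDual (C : MinFreeRes R M) : Prop :=
  ∃ r : ℕ, (∀ n, r < n → Subsingleton (C.F n)) ∧ Nontrivial (C.F r) ∧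
    ∃ e : ∀ ⦃m n : ℕ⦄, m + n = r → (C.F n ≃ₗ[R] Module.Dual R (C.F m)),
      ∀ (q n : ℕ) (hp : (q + 1) + n = r) (hq : q + (n + 1) = r),
        (e hp).toLinearMap ∘ₗ C.d n = (C.d q).dualMap ∘ₗ (e hq).toLinearMap

/-- A minimal free resolution is eventually periodic with period `a` if
`Ωⁿ M ≅ Ωⁿ⁺ᵃ M` for some `n`. -/
def EventuallyPeriodic (C : MinFreeRes R M) (a : ℕ) : Prop :=
  0 < a ∧ ∃ n : ℕ, Nonempty (C.Syz n ≃ₗ[R] C.Syz (n + a))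

end MinFreeRes

/-- Stable isomorphism: `X ⊕ P ≅ Y ⊕ Q` for some finite free `P`, `Q`. -/
def StablyIso (R : Type) [CommRing R] (X Y : Type) [AddCommGroup X] [Module R X]
    [AddCommGroup Y] [Module R Y] : Prop :=
  ∃ (P Q : ModuleCat.{0} R), Module.Free R P ∧ Module.Finite R P ∧
    Module.Free R Q ∧ Module.Finite R Q ∧ Nonempty ((X × P) ≃ₗ[R] (Y × Q))

/-- The depth of a module over a noetherian local ring, as the least `i`
with `Ext^i_R(k, M) ≠ 0`. -/
noncomputable def localDepth (R : Type) [CommRing R] [IsLocalRing R]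
    (M : Type) [AddCommGroup M] [Module R M] : ℕ :=
  sInf {i | Nontrivial (ExtMod R (ResidueField R) M i)}

/-- A noetherian local ring is regular if its maximal ideal can be generated by
`dim R` elements. -/
def IsRegularLocal (R : Type) [CommRing R] [IsLocalRing R] : Prop :=
  ∃ s : Finset R, Ideal.span (s : Set R) = maximalIdeal R ∧
    ((s.card : ℕ∞) : WithBot ℕ∞) = ringKrullDim R

namespace MinFreeRes

variable {R : Type} [CommRing R] [IsLocalRing R]
  {M : Type} [AddCommGroup M] [Module R M] (C : MinFreeRes R M)

instance (n : ℕ) : Module.Free R (C.F n) := C.free n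

instance (n : ℕ) : Module.Finite R (C.F n) := C.fin n

lemma exact_aug_d : Function.Exact (C.d 0) C.aug :=
  LinearMap.exact_iff.2 C.exact_aug

lemma exact_d (n : ℕ) : Function.Exact (C.d (n + 1)) (C.d n) :=
  LinearMap.exact_iff.2 (C.exact n)

/-- The underlying chain complex of a minimal free resolution. -/
noncomputable def complex : ChainComplex (ModuleCat.{0} R) ℕ :=
  ChainComplex.of C.F (fun n ↦ ModuleCat.ofHom (C.d n)) fun n ↦ by
    ext x
    exact (C.exact_d n).apply_apply_eq_zero x

lemma complex_d (n : ℕ) : C.complex.d (n + 1) n = ModuleCat.ofHom (C.d n) :=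
  ChainComplex.of_d C.F (fun n ↦ ModuleCat.ofHom (C.d n)) n

lemma complex_exactAt_succ (n : ℕ) : C.complex.ExactAt (n + 1) := by
  rw [HomologicalComplex.exactAt_iff' _ (n + 2) (n + 1) n (by simp) (by simp)]
  refine ModuleCat.shortComplex_exact _ ?_
  have h₁ : (C.complex.sc' (n + 2) (n + 1) n).f = ModuleCat.ofHom (C.d (n + 1)) := C.complex_d _
  have h₂ : (C.complex.sc' (n + 2) (n + 1) n).g = ModuleCat.ofHom (C.d n) := C.complex_d _
  rw [h₁, h₂]
  exact C.exact_d n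

/-- The augmentation as a chain map to the complex concentrated in degree zero. -/
noncomputable def augHom : C.complex ⟶ (ChainComplex.single₀ _).obj (ModuleCat.of R M) :=
  (ChainComplex.toSingle₀Equiv _ _).symm ⟨ModuleCat.ofHom C.aug, by
    rw [complex_d]
    ext x
    exact C.exact_aug_d.apply_apply_eq_zero x⟩

lemma augHom_f_zero : C.augHom.f 0 = ModuleCat.ofHom C.aug :=
  ChainComplex.toSingle₀Equiv_symm_apply_f_zero ..

/-- A minimal free resolution as a projective resolution in the category of modules. -/
noncomputable def projectiveResolution : ProjectiveResolution (ModuleCat.of R M) where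
  complex := C.complex
  projective n := by
    change Projective (C.F n)
    have : Module.Projective R (C.F n) := Module.Projective.of_free
    exact (IsProjective.iff_projective _).1 this
  π := C.augHom
  quasiIso := ⟨fun n ↦ by
    cases n
    · rw [ChainComplex.quasiIsoAt₀_iff, ShortComplex.quasiIso_iff_of_zeros']
      · have key : (ShortComplex.mk (ModuleCat.ofHom (C.d 0)) (ModuleCat.ofHom C.aug)
            (by ext x; exact C.exact_aug_d.apply_apply_eq_zero x)).Exact ∧
            Epi (ModuleCat.ofHom C.aug) :=
          ⟨ModuleCat.shortComplex_exact _ C.exact_aug_d,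
            (ModuleCat.epi_iff_surjective _).2 C.aug_surj⟩
        refine (ShortComplex.exact_and_epi_g_iff_of_iso ?_).2 key
        exact ShortComplex.isoMk (Iso.refl _) (Iso.refl _) (Iso.refl _)
          ((Category.id_comp _).trans ((Category.comp_id _).trans (C.complex_d 0)).symm)
          ((Category.id_comp _).trans ((Category.comp_id _).trans C.augHom_f_zero).symm)
      all_goals rfl
    · rw [quasiIsoAt_iff_exactAt']
      · apply complex_exactAt_succ
      · apply ChainComplex.exactAt_succ_single_obj⟩

lemma linearYonedaObj_d_apply (n : ℕ) (φ : C.F n →ₗ[R] R) :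
    (C.complex.linearYonedaObj R (ModuleCat.of R R)).d n (n + 1) (ModuleCat.ofHom φ) =
      ModuleCat.ofHom ((C.d n).dualMap φ) := by
  have : (C.complex.linearYonedaObj R (ModuleCat.of R R)).d n (n + 1) (ModuleCat.ofHom φ) =
    C.complex.d (n + 1) n ≫ ModuleCat.ofHom φ := rfl
  rw [this, complex_d]
  rfl

/-- `Ext` into `R` in positive degree `n + 1` vanishes iff the dual complex is exact there. -/
lemma subsingleton_extMod_succ_iff (n : ℕ) :
    Subsingleton (ExtMod R M R (n + 1)) ↔
      Function.Exact (C.d n).dualMap (C.d (n + 1)).dualMap := by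
  have e := C.projectiveResolution.isoExt (R := R) (n + 1) (ModuleCat.of R R)
  rw [ExtMod, e.toLinearEquiv.subsingleton_congr, ← ModuleCat.isZero_iff_subsingleton,
    ← HomologicalComplex.exactAt_iff_isZero_homology,
    HomologicalComplex.exactAt_iff' _ n (n + 1) (n + 2) (by simp) (by simp),
    ShortComplex.ShortExact.moduleCat_exact_iff_function_exact]
  have hf (φ : Module.Dual R (C.F n)) := C.linearYonedaObj_d_apply n φ
  have hg (φ : Module.Dual R (C.F (n + 1))) := C.linearYonedaObj_d_apply (n + 1) φ
  constructor
  · intro H φ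
    have := H (ModuleCat.ofHom φ)
    constructor
    · intro h
      obtain ⟨ψ, hψ⟩ := this.1 ((hg φ).trans (by rw [h]; rfl))
      exact ⟨ModuleCat.Hom.hom ψ, congrArg ModuleCat.Hom.hom ((hf _).symm.trans hψ)⟩
    · rintro ⟨ψ, rfl⟩
      exact congrArg ModuleCat.Hom.hom ((hg _).symm.trans (this.2 ⟨ModuleCat.ofHom ψ, hf ψ⟩))
  · intro H φ
    have := H (ModuleCat.Hom.hom φ)
    constructor
    · intro h
      obtain ⟨ψ, hψ⟩ := this.1 (congrArg ModuleCat.Hom.hom ((hg _).symm.trans h))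
      exact ⟨ModuleCat.ofHom ψ, (hf ψ).trans (by rw [hψ]; rfl)⟩
    · rintro ⟨ψ, rfl⟩
      exact (hg _).trans ((congrArg ModuleCat.ofHom (this.2 ⟨ModuleCat.Hom.hom ψ,
        congrArg ModuleCat.Hom.hom (hf _).symm⟩)).trans rfl)

lemma subsingleton_extMod_zero_iff :
    Subsingleton (ExtMod R M R 0) ↔ Function.Injective (C.d 0).dualMap := by
  have e := C.projectiveResolution.isoExt (R := R) 0 (ModuleCat.of R R)
  rw [ExtMod, e.toLinearEquiv.subsingleton_congr, ← ModuleCat.isZero_iff_subsingleton,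
    ← HomologicalComplex.exactAt_iff_isZero_homology,
    HomologicalComplex.exactAt_iff' _ 0 0 1 (by simp) (by simp),
    ShortComplex.ShortExact.moduleCat_exact_iff_function_exact]
  have hg (φ : Module.Dual R (C.F 0)) := C.linearYonedaObj_d_apply 0 φ
  have hf (φ) : (C.complex.linearYonedaObj R (ModuleCat.of R R)).d 0 0 φ = 0 := by
    rw [HomologicalComplex.shape _ _ _ (by simp)]
    rfl
  rw [injective_iff_map_eq_zero]
  constructor
  · intro H φ h
    obtain ⟨ψ, hψ⟩ := (H (ModuleCat.ofHom φ)).1 ((hg φ).trans (by rw [h]; rfl))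
    exact congrArg ModuleCat.Hom.hom (hψ.symm.trans (hf ψ))
  · intro H φ
    constructor
    · intro h
      have : ModuleCat.Hom.hom φ = 0 := H _ (congrArg ModuleCat.Hom.hom ((hg _).symm.trans h))
      exact ⟨0, (map_zero _).trans (congrArg ModuleCat.ofHom this).symm⟩
    · rintro ⟨ψ, rfl⟩
      exact (congrArg _ (hf ψ)).trans (map_zero _)

end MinFreeRes
section ExtOfShortExact

universe u

variable {R : Type u} [CommRing R]

lemma subsingleton_ext_add_two_iff {S : ShortComplex (ModuleCat.{u} R)} (hS : S.ShortExact)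
    [Projective S.X₂] (L : ModuleCat.{u} R) (n : ℕ) :
    Subsingleton (Abelian.Ext S.X₃ L (n + 2)) ↔ Subsingleton (Abelian.Ext S.X₁ L (n + 1)) := by
  have h := precomp_extClass_surjective_of_projective_X₂ L hS (n + 1)
  refine ⟨fun _ ↦ ⟨fun x y ↦ ?_⟩, fun _ ↦ h.subsingleton⟩
  obtain ⟨z, hz⟩ := Abelian.Ext.contravariant_sequence_exact₁ hS L (x - y) (add_comm 1 (n + 1))
    (Subsingleton.elim _ _)
  rw [Abelian.Ext.eq_zero_of_projective z, Abelian.Ext.comp_zero] at hz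
  exact sub_eq_zero.1 hz.symm

lemma subsingleton_ext_one_iff {S : ShortComplex (ModuleCat.{u} R)} (hS : S.ShortExact)
    [Projective S.X₂] (L : ModuleCat.{u} R) :
    Subsingleton (Abelian.Ext S.X₃ L 1) ↔ ∀ φ : S.X₁ ⟶ L, ∃ ψ : S.X₂ ⟶ L, S.f ≫ ψ = φ := by
  constructor
  · intro _ φ
    obtain ⟨z, hz⟩ := Abelian.Ext.contravariant_sequence_exact₁ hS L (Abelian.Ext.mk₀ φ)
      (add_comm 1 0) (Subsingleton.elim _ _)
    obtain ⟨ψ, rfl⟩ := (Abelian.Ext.mk₀_bijective _ _).2 z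
    rw [Abelian.Ext.mk₀_comp_mk₀] at hz
    exact ⟨ψ, (Abelian.Ext.mk₀_bijective _ _).1 hz⟩
  · intro h
    refine ⟨fun x y ↦ ?_⟩
    obtain ⟨z, hz⟩ := Abelian.Ext.contravariant_sequence_exact₃ hS L (x - y)
      (Abelian.Ext.eq_zero_of_projective (n := 0) _) (add_comm 1 0)
    obtain ⟨φ, rfl⟩ := (Abelian.Ext.mk₀_bijective _ _).2 z
    obtain ⟨ψ, rfl⟩ := h φ
    rw [← sub_eq_zero, ← hz, ← Abelian.Ext.mk₀_comp_mk₀]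
    exact hS.extClass_comp_assoc _

lemma subsingleton_ext_iff_of_iso {X Y : ModuleCat.{u} R} (e : X ≅ Y) (L : ModuleCat.{u} R)
    (n : ℕ) : Subsingleton (Abelian.Ext X L n) ↔ Subsingleton (Abelian.Ext Y L n) := by
  have key {X Y : ModuleCat.{u} R} (e : X ≅ Y) (_ : Subsingleton (Abelian.Ext X L n)) :
      Subsingleton (Abelian.Ext Y L n) := by
    refine Function.Injective.subsingleton
      (f := fun x ↦ (Abelian.Ext.mk₀ e.hom).comp x (zero_add n)) fun x y hxy ↦ ?_
    simpa using congrArg (fun z ↦ (Abelian.Ext.mk₀ e.inv).comp z (zero_add n)) hxy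
  exact ⟨key e, key e.symm⟩

variable {K P N : Type u} [AddCommGroup K] [AddCommGroup P] [AddCommGroup N]
  [Module R K] [Module R P] [Module R N] {f : K →ₗ[R] P} {g : P →ₗ[R] N}

/-- The short complex of modules attached to an exact pair of linear maps. -/
abbrev Function.Exact.shortComplex (h : Function.Exact f g) : ShortComplex (ModuleCat.{u} R) :=
  ModuleCat.shortComplexOfCompEqZero f g h.linearMap_comp_eq_zero

lemma Function.Exact.shortExact (h : Function.Exact f g) (hf : Function.Injective f)
    (hg : Function.Surjective g) : h.shortComplex.ShortExact :=
  ModuleCat.shortComplex_shortExact _ h hf hg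

instance [Module.Projective R P] (h : Function.Exact f g) : Projective h.shortComplex.X₂ :=
  (IsProjective.iff_projective P).1 inferInstance

end ExtOfShortExact

lemma LinearMap.exists_comp_eq_of_ker_le {R M N P : Type*} [Ring R] [AddCommGroup M]
    [AddCommGroup N] [AddCommGroup P] [Module R M] [Module R N] [Module R P] {f : M →ₗ[R] N}
    (hf : Function.Surjective f) {g : M →ₗ[R] P} (h : LinearMap.ker f ≤ LinearMap.ker g) :
    ∃ g' : N →ₗ[R] P, g' ∘ₗ f = g := by
  refine ⟨(LinearMap.ker f).liftQ g h ∘ₗ (f.quotKerEquivOfSurjective hf).symm.toLinearMap, ?_⟩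
  ext x
  have : (f.quotKerEquivOfSurjective hf).symm (f x) = (LinearMap.ker f).mkQ x :=
    (LinearEquiv.symm_apply_eq _).2 rfl
  simp [this]

namespace MinFreeRes

variable {R : Type} [CommRing R] [IsLocalRing R]
  {M : Type} [AddCommGroup M] [Module R M] (C : MinFreeRes R M)

/-- The canonical surjection from the `n`-th free module onto the `n`-th syzygy. -/
noncomputable def cover : ∀ n, C.F n →ₗ[R] C.Syz n
  | 0 => C.aug
  | n + 1 => (C.d n).rangeRestrict

/-- The inclusion of a syzygy in the free module covering the previous one. -/
noncomputable def incl (n : ℕ) : C.Syz (n + 1) →ₗ[R] C.F n :=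
  (LinearMap.range (C.d n)).subtype

lemma incl_injective (n : ℕ) : Function.Injective (C.incl n) := Subtype.val_injective

lemma cover_surjective : ∀ n, Function.Surjective (C.cover n)
  | 0 => C.aug_surj
  | n + 1 => (C.d n).surjective_rangeRestrict

lemma exact_incl_cover (n : ℕ) : Function.Exact (C.incl n) (C.cover n) := by
  have h : LinearMap.range (C.incl n) = LinearMap.range (C.d n) := Submodule.range_subtype _
  rw [LinearMap.exact_iff, h]
  cases n with
  | zero => exact C.exact_aug
  | succ n => exact (LinearMap.ker_rangeRestrict _).trans (C.exact n)

lemma shortExact_incl_cover (n : ℕ) : (C.exact_incl_cover n).shortComplex.ShortExact :=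
  (C.exact_incl_cover n).shortExact (C.incl_injective n) (C.cover_surjective n)

lemma subsingleton_ext_syz_one_iff (n : ℕ) :
    Subsingleton (Abelian.Ext (ModuleCat.of R (C.Syz n)) (ModuleCat.of R R) 1) ↔
      Function.Exact (C.d n).dualMap (C.d (n + 1)).dualMap := by
  rw [subsingleton_ext_one_iff (C.shortExact_incl_cover n)]
  constructor
  · intro h φ
    constructor
    · intro hφ
      have hle : LinearMap.ker (C.cover (n + 1)) ≤ LinearMap.ker φ := by
        intro x hx
        obtain ⟨y, rfl⟩ := (C.exact_incl_cover (n + 1) x).1 hx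
        obtain ⟨z, rfl⟩ := C.cover_surjective _ y
        exact LinearMap.congr_fun hφ z
      obtain ⟨φ', hφ'⟩ := LinearMap.exists_comp_eq_of_ker_le (C.cover_surjective (n + 1)) hle
      obtain ⟨ψ, hψ⟩ := h (ModuleCat.ofHom φ')
      refine ⟨ModuleCat.Hom.hom ψ, ?_⟩
      rw [← hφ']
      ext x
      exact LinearMap.congr_fun (congrArg ModuleCat.Hom.hom hψ) (C.cover (n + 1) x)
    · rintro ⟨ψ, rfl⟩
      ext x
      simp [LinearMap.dualMap_apply, (C.exact_d n).apply_apply_eq_zero]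
  · intro h φ
    obtain ⟨ψ, hψ⟩ := (h (φ.hom ∘ₗ C.cover (n + 1))).1 (by
      ext x
      have : C.cover (n + 1) (C.d (n + 1) x) = 0 :=
        (C.exact_incl_cover (n + 1)).apply_apply_eq_zero (C.cover (n + 2) x)
      simp [LinearMap.dualMap_apply, this])
    refine ⟨ModuleCat.ofHom ψ, ?_⟩
    ext y
    obtain ⟨x, rfl⟩ := C.cover_surjective _ y
    exact LinearMap.congr_fun hψ x

lemma subsingleton_ext_syz_iff (m n : ℕ) :
    Subsingleton (Abelian.Ext (ModuleCat.of R (C.Syz m)) (ModuleCat.of R R) (n + 1)) ↔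
      Function.Exact (C.d (m + n)).dualMap (C.d (m + n + 1)).dualMap := by
  induction n generalizing m with
  | zero => exact C.subsingleton_ext_syz_one_iff m
  | succ n ih =>
    rw [show m + (n + 1) = m + 1 + n by ring, ← ih]
    exact subsingleton_ext_add_two_iff (C.shortExact_incl_cover m) _ n

lemma hasProjectiveDimensionLT_of_syz (m n : ℕ)
    (h : HasProjectiveDimensionLT (ModuleCat.of R (C.Syz m)) n) :
    HasProjectiveDimensionLT (ModuleCat.of R M) (m + n) := by
  induction m generalizing n with
  | zero => rwa [zero_add]
  | succ m ih =>
    rw [add_assoc, add_comm 1 n]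
    refine ih (n + 1) ((C.shortExact_incl_cover m).hasProjectiveDimensionLT_X₃ n h ?_)
    exact hasProjectiveDimensionLT_of_ge _ 1 _ (by lia)

/-- The image of the dual of the differential `F (n + 1) → F n`. -/
noncomputable abbrev dualRange (n : ℕ) : Submodule R (Module.Dual R (C.F (n + 1))) :=
  LinearMap.range (C.d n).dualMap

/-- Exactness of the dual complex in cohomological degree `n`. -/
def DualExactAt : ℕ → Prop
  | 0 => Function.Injective (C.d 0).dualMap
  | n + 1 => Function.Exact (C.d n).dualMap (C.d (n + 1)).dualMap

/-- The short complex `im dₙ* → Fₙ₊₁* → im dₙ₊₁*`. -/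
noncomputable abbrev dualComplex (n : ℕ) : ShortComplex (ModuleCat.{0} R) where
  X₁ := ModuleCat.of R (C.dualRange n)
  X₂ := ModuleCat.of R (Module.Dual R (C.F (n + 1)))
  X₃ := ModuleCat.of R (C.dualRange (n + 1))
  f := ModuleCat.ofHom (C.dualRange n).subtype
  g := ModuleCat.ofHom (C.d (n + 1)).dualMap.rangeRestrict
  zero := by
    have : (C.d (n + 1)).dualMap.rangeRestrict ∘ₗ (C.dualRange n).subtype = 0 := by
      ext ⟨_, θ, rfl⟩ y
      simp [LinearMap.dualMap_apply, (C.exact_d n).apply_apply_eq_zero]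
    exact ModuleCat.hom_ext this

instance (n : ℕ) : Projective (C.dualComplex n).X₂ :=
  (IsProjective.iff_projective (Module.Dual R (C.F (n + 1)))).1 inferInstance

variable {C}

lemma shortExact_dualComplex {n : ℕ} (h : C.DualExactAt (n + 1)) :
    (C.dualComplex n).ShortExact := by
  refine ModuleCat.shortComplex_shortExact (C.dualComplex n) (fun θ ↦ ?_) Subtype.val_injective
    (C.d (n + 1)).dualMap.surjective_rangeRestrict
  refine Subtype.ext_iff.trans ((h θ).trans ?_)
  exact ⟨fun hθ ↦ ⟨⟨θ, hθ⟩, rfl⟩, by rintro ⟨⟨_, hθ⟩, rfl⟩; exact hθ⟩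

lemma subsingleton_ext_dualRange_iff {m n : ℕ} (h : ∀ p ≤ m + n, C.DualExactAt p) :
    Subsingleton (Abelian.Ext (ModuleCat.of R (C.dualRange (m + n))) (ModuleCat.of R R) (n + 1)) ↔
      Subsingleton (Abelian.Ext (ModuleCat.of R (C.dualRange m)) (ModuleCat.of R R) 1) := by
  induction n with
  | zero => rfl
  | succ n ih =>
    rw [← ih fun p hp ↦ h p (by lia)]
    exact subsingleton_ext_add_two_iff (shortExact_dualComplex (h (m + n + 1) le_rfl)) _ n

lemma subsingleton_ext_dualRange_add_two {n : ℕ} (h : C.DualExactAt (n + 2)) :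
    Subsingleton
      (Abelian.Ext (ModuleCat.of R (C.dualRange (n + 2))) (ModuleCat.of R R) 1) := by
  refine (subsingleton_ext_one_iff (shortExact_dualComplex h) _).2 fun φ ↦ ?_
  obtain ⟨x, hx⟩ := (Module.bijective_dual_eval R (C.F (n + 1))).2
    (φ.hom ∘ₗ (C.d (n + 1)).dualMap.rangeRestrict)
  have hx' (θ : Module.Dual R (C.F (n + 1))) :
      θ x = φ.hom ((C.d (n + 1)).dualMap.rangeRestrict θ) := LinearMap.congr_fun hx θ
  have h0 : C.d n x = 0 := by
    rw [← Module.forall_dual_apply_eq_zero_iff R]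
    intro θ
    have : (C.d (n + 1)).dualMap.rangeRestrict ((C.d n).dualMap θ) = 0 := by
      ext y
      simp [LinearMap.dualMap_apply, (C.exact_d n).apply_apply_eq_zero]
    refine (hx' ((C.d n).dualMap θ)).trans ?_
    rw [this, map_zero]
  obtain ⟨y, rfl⟩ := (C.exact_d n x).1 h0
  refine ⟨ModuleCat.ofHom (Module.Dual.eval R _ y), ?_⟩
  ext ⟨_, θ, rfl⟩
  exact hx' θ

lemma not_subsingleton_ext_dualRange_one [Nontrivial M] (h0 : C.DualExactAt 0)
    (h : C.DualExactAt 1) :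
    ¬ Subsingleton
      (Abelian.Ext (ModuleCat.of R (C.dualRange 1)) (ModuleCat.of R R) 1) := by
  intro hs
  replace hs := (subsingleton_ext_one_iff (shortExact_dualComplex h) _).1 hs
  have hsurj (x : C.F 0) : ∃ y, C.d 0 y = x := by
    let e : Module.Dual R (C.F 0) ≃ₗ[R] C.dualRange 0 := LinearEquiv.ofInjective _ h0
    obtain ⟨ψ, hψ⟩ := hs (ModuleCat.ofHom (Module.Dual.eval R _ x ∘ₗ e.symm.toLinearMap))
    obtain ⟨y, hy⟩ := (Module.bijective_dual_eval R (C.F 1)).2 ψ.hom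
    refine ⟨y, ?_⟩
    rw [← sub_eq_zero, ← Module.forall_dual_apply_eq_zero_iff R]
    intro θ
    have h₁ := LinearMap.congr_fun (congrArg ModuleCat.Hom.hom hψ) (e θ)
    have h₂ : Module.Dual.eval R _ y ((C.d 0).dualMap θ) = e.symm (e θ) x :=
      (LinearMap.congr_fun hy _).trans h₁
    rw [LinearEquiv.symm_apply_apply] at h₂
    rw [map_sub, sub_eq_zero]
    exact h₂
  obtain ⟨m, hm⟩ := exists_ne (0 : M)
  obtain ⟨x, rfl⟩ := C.aug_surj m
  obtain ⟨y, rfl⟩ := hsurj x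
  exact hm (C.exact_aug_d.apply_apply_eq_zero y)

lemma hasProjectiveDimensionLT_dualRange {n : ℕ} (h : ∀ p ≤ n, C.DualExactAt p) :
    HasProjectiveDimensionLT (ModuleCat.of R (C.dualRange n)) (n + 1) := by
  induction n with
  | zero =>
    have : Module.Projective R (C.dualRange 0) :=
      .of_equiv (LinearEquiv.ofInjective _ (h 0 le_rfl))
    have := (IsProjective.iff_projective (C.dualRange 0)).1 this
    infer_instance
  | succ n ih =>
    exact (shortExact_dualComplex (h (n + 1) le_rfl)).hasProjectiveDimensionLT_X₃ (n + 1)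
      (ih fun p hp ↦ h p (by lia)) (hasProjectiveDimensionLT_of_ge _ 1 _ (by lia))

/-- The dual of a syzygy is the image of the dual of the preceding differential. -/
lemma nonempty_dual_syz_equiv {n : ℕ} (h : C.DualExactAt (n + 1)) :
    Nonempty (Module.Dual R (C.Syz (n + 1)) ≃ₗ[R] C.dualRange n) := by
  have hinj : Function.Injective (C.cover (n + 1)).dualMap :=
    LinearMap.dualMap_injective_of_surjective (C.cover_surjective _)
  have hr : LinearMap.range (C.cover (n + 1)).dualMap = C.dualRange n := by
    ext φ
    constructor
    · rintro ⟨ψ, rfl⟩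
      refine (h _).1 ?_
      ext x
      have : C.cover (n + 1) (C.d (n + 1) x) = 0 :=
        (C.exact_incl_cover (n + 1)).apply_apply_eq_zero (C.cover (n + 2) x)
      simp [LinearMap.dualMap_apply, this]
    · rintro ⟨ψ, rfl⟩
      exact ⟨ψ ∘ₗ C.incl n, rfl⟩
  exact ⟨(LinearEquiv.ofInjective _ hinj).trans (LinearEquiv.ofEq _ _ hr)⟩

end MinFreeRes

namespace MinFreeRes

variable {R : Type} [CommRing R] [IsLocalRing R]
  {M : Type} [AddCommGroup M] [Module R M] (C : MinFreeRes R M)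

lemma subsingleton_extMod_iff (n : ℕ) : Subsingleton (ExtMod R M R n) ↔ C.DualExactAt n := by
  cases n with
  | zero => exact C.subsingleton_extMod_zero_iff
  | succ n => exact C.subsingleton_extMod_succ_iff n

/-- If the dual complex has its first cohomology in degree `t`, and the `i`-th syzygy with
`2 ≤ i < t` is isomorphic to its dual, then `t = 2 * i - 1`. -/
lemma eq_of_dual_syz_equiv [Nontrivial M] {t n : ℕ} (hn : n + 2 < t)
    (h : ∀ p < t, C.DualExactAt p) (ht : ¬ C.DualExactAt t)
    (e : C.Syz (n + 2) ≃ₗ[R] C.dualRange (n + 1)) : t = 2 * n + 3 := by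
  have key (m j : ℕ) (hmj : m + j = n + 1) : C.DualExactAt (n + 2 + j + 1) ↔
      Subsingleton (Abelian.Ext (ModuleCat.of R (C.dualRange m)) (ModuleCat.of R R) 1) := by
    rw [← subsingleton_ext_dualRange_iff (n := j) fun p hp ↦ h p (by lia), hmj,
      ← subsingleton_ext_iff_of_iso e.toModuleIso]
    exact (C.subsingleton_ext_syz_iff (n + 2) j).symm
  have hle : t ≤ 2 * n + 3 := by
    by_contra! hlt
    exact not_subsingleton_ext_dualRange_one (h 0 (by lia)) (h 1 (by lia))
      ((key 1 n (add_comm _ _)).1 (h _ (by lia)))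
  by_contra hne
  obtain ⟨j, rfl⟩ := Nat.exists_eq_add_of_lt hn
  obtain ⟨m, rfl⟩ := Nat.exists_eq_add_of_le (show j + 1 ≤ n by lia)
  exact ht ((key (m + 2) j (by lia)).2 (subsingleton_ext_dualRange_add_two (h _ (by lia))))

/-- If the dual complex is exact in degrees up to `n + 2` and the syzygy of order `n + 2` is
isomorphic to its dual, then the resolved module has finite projective dimension. -/
lemma hasProjectiveDimensionLT_of_syz_equiv {n : ℕ} (h : ∀ p ≤ n + 1, C.DualExactAt p)
    (e : C.Syz (n + 2) ≃ₗ[R] C.dualRange (n + 1)) :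
    HasProjectiveDimensionLT (ModuleCat.of R M) (n + 2 + (n + 2)) :=
  C.hasProjectiveDimensionLT_of_syz (n + 2) (n + 2) <|
    have := hasProjectiveDimensionLT_dualRange h
    let e' : C.Syz (n + 2) ≅ ModuleCat.of R (C.dualRange (n + 1)) := e.toModuleIso
    hasProjectiveDimensionLT_of_iso e'.symm (n + 2)

end MinFreeRes

section Serre

universe u

variable {R : Type u} [CommRing R]

lemma LinearMap.hasProjectiveDimensionLT_ker {F M : Type u} [AddCommGroup F] [Module R F]
    [AddCommGroup M] [Module R M] [Module.Projective R F] {g : F →ₗ[R] M}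
    (hg : Function.Surjective g) {n : ℕ}
    (h : HasProjectiveDimensionLT (ModuleCat.of R M) (n + 2)) :
    HasProjectiveDimensionLT (ModuleCat.of R (LinearMap.ker g)) (n + 1) :=
  ((LinearMap.shortExact_shortComplexKer hg).hasProjectiveDimensionLT_X₃_iff n
    ((IsProjective.iff_projective F).1 inferInstance)).1 h

lemma subsingleton_of_hasProjectiveDimensionLT_zero {M : Type u} [AddCommGroup M] [Module R M]
    (h : HasProjectiveDimensionLT (ModuleCat.of R M) 0) : Subsingleton M :=
  ModuleCat.isZero_iff_subsingleton.1 (isZero_of_hasProjectiveDimensionLT_zero (ModuleCat.of R M))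

lemma projective_of_hasProjectiveDimensionLT_one {M : Type u} [AddCommGroup M] [Module R M]
    (h : HasProjectiveDimensionLT (ModuleCat.of R M) 1) : Module.Projective R M :=
  (IsProjective.iff_projective M).2 (projective_iff_hasProjectiveDimensionLT_one.2 h)

/-- In a local ring of depth zero, finite modules of finite projective dimension are free. -/
lemma free_of_hasProjectiveDimensionLT [IsLocalRing R] [IsNoetherianRing R] {s : R} (hs : s ≠ 0)
    (hsm : ∀ y ∈ maximalIdeal R, s * y = 0) {n : ℕ} {M : Type u} [AddCommGroup M] [Module R M]
    [Module.Finite R M] (h : HasProjectiveDimensionLT (ModuleCat.of R M) n) :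
    Module.Free R M := by
  induction n using Nat.twoStepInduction generalizing M with
  | zero =>
    have := subsingleton_of_hasProjectiveDimensionLT_zero h
    infer_instance
  | one =>
    have := projective_of_hasProjectiveDimensionLT_one h
    exact Module.free_of_flat_of_isLocalRing
  | more n _ ih =>
    obtain ⟨r, g, hg⟩ := Module.Finite.exists_fin' R M
    have := ih (LinearMap.hasProjectiveDimensionLT_ker hg h)
    refine Module.free_of_lTensor_residueField_injective (LinearMap.ker g).subtype g hg
      (LinearMap.exact_subtype_ker_map g) ?_
    have hsurj : Function.Surjective (TensorProduct.mk R (ResidueField R) (LinearMap.ker g) 1) :=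
      TensorProduct.mk_surjective _ _ _ residue_surjective
    rw [injective_iff_map_eq_zero, hsurj.forall]
    intro v hv
    have hv' : (v : Fin r → R) ∈ maximalIdeal R • (⊤ : Submodule R (Fin r → R)) := by
      rw [← LinearMap.ker_tensorProductMk]
      exact hv
    have hsv : s • v = 0 := by
      refine Subtype.ext ?_
      refine Submodule.smul_induction_on (p := fun w ↦ s • w = 0) hv' ?_ ?_
      · intro y hy w _
        rw [smul_smul, hsm y hy, zero_smul]
      · intro w w' hw hw'
        rw [smul_add, hw, hw', add_zero]
    suffices hmem : v ∈ maximalIdeal R • (⊤ : Submodule R (LinearMap.ker g)) by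
      rw [← LinearMap.ker_tensorProductMk] at hmem
      exact hmem
    let b := Module.Free.chooseBasis R (LinearMap.ker g)
    rw [← b.sum_repr v]
    refine Submodule.sum_mem _ fun i _ ↦ Submodule.smul_mem_smul ?_ trivial
    rw [mem_maximalIdeal, mem_nonunits_iff]
    intro hu
    have : s * b.repr v i = 0 := by simpa using congrArg (fun w ↦ b.repr w i) hsv
    exact hs ((hu.mul_left_eq_zero).1 this)

/-- Reduction modulo a regular element does not increase the projective dimension. -/
lemma hasProjectiveDimensionLT_quotSMulTop {x : R} (hx : IsSMulRegular R x) {n : ℕ} {M : Type u}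
    [AddCommGroup M] [Module R M] (hM : IsSMulRegular M x)
    (h : HasProjectiveDimensionLT (ModuleCat.of R M) n) :
    HasProjectiveDimensionLT (ModuleCat.of (R ⧸ Ideal.span {x}) (QuotSMulTop x M)) n := by
  have hproj {P : Type u} [AddCommGroup P] [Module R P] [Module.Projective R P] :
      Module.Projective (R ⧸ Ideal.span {x}) (QuotSMulTop x P) :=
    .of_equiv ((QuotSMulTop.equivQuotTensor x P).extendScalarsOfSurjective
      Ideal.Quotient.mk_surjective).symm
  induction n using Nat.twoStepInduction generalizing M with
  | zero =>
    have := subsingleton_of_hasProjectiveDimensionLT_zero h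
    exact (ModuleCat.isZero_of_subsingleton _).hasProjectiveDimensionLT_zero
  | one =>
    have := projective_of_hasProjectiveDimensionLT_one h
    exact projective_iff_hasProjectiveDimensionLT_one.1 ((IsProjective.iff_projective _).1 hproj)
  | more n _ ih =>
    obtain ⟨F, _, _, _, g, hg, hF⟩ : ∃ (F : Type u) (_ : AddCommGroup F) (_ : Module R F)
        (_ : Module.Projective R F) (g : F →ₗ[R] M),
        Function.Surjective g ∧ IsSMulRegular F x :=
      ⟨M →₀ R, inferInstance, inferInstance, inferInstance, Finsupp.linearCombination R id,
        Finsupp.linearCombination_id_surjective R M, fun a b hab ↦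
          Finsupp.ext fun i ↦ hx (DFunLike.congr_fun hab i)⟩
    have hK : IsSMulRegular (LinearMap.ker g) x := hF.submodule _ _
    have hR' : Function.Surjective (algebraMap R (R ⧸ Ideal.span {x})) :=
      Ideal.Quotient.mk_surjective
    let f' := (QuotSMulTop.map x (LinearMap.ker g).subtype).extendScalarsOfSurjective hR'
    let g' := (QuotSMulTop.map x g).extendScalarsOfSurjective hR'
    have hex := LinearMap.exact_subtype_ker_map g
    have h' : Function.Exact f' g' := QuotSMulTop.map_exact x hex hg
    have hf' : Function.Injective f' := by
      have h0 : Function.Exact (0 : LinearMap.ker g →ₗ[R] LinearMap.ker g)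
          (LinearMap.ker g).subtype := by
        rw [LinearMap.exact_zero_iff_injective]
        exact Subtype.val_injective
      have := QuotSMulTop.map_first_exact_on_four_term_exact_of_isSMulRegular_last h0 hex hM
      rw [map_zero, LinearMap.exact_zero_iff_injective] at this
      exact this
    have hp : Projective (ModuleCat.of (R ⧸ Ideal.span {x}) (QuotSMulTop x F)) :=
      (IsProjective.iff_projective _).1 hproj
    exact ((h'.shortExact hf' (QuotSMulTop.map_surjective x hg)).hasProjectiveDimensionLT_X₃_iff n
      hp).2 (ih hK (LinearMap.hasProjectiveDimensionLT_ker hg h))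

/-- In a local ring of positive depth, some minimal generator of the maximal ideal is regular. -/
lemma exists_isSMulRegular_of_forall_exists_mul_ne_zero [IsLocalRing R] [IsNoetherianRing R]
    (h : ∀ s : R, s ≠ 0 → ∃ y ∈ maximalIdeal R, s * y ≠ 0) :
    ∃ x ∈ maximalIdeal R, x ∉ maximalIdeal R ^ 2 ∧ IsSMulRegular R x := by
  classical
  by_contra! hcon
  let T := insert (maximalIdeal R ^ 2) (associatedPrimes.finite R R).toFinset
  have hsub : (maximalIdeal R : Set R) ⊆ ⋃ I ∈ (↑T : Set (Ideal R)), id I := by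
    intro x hx
    by_cases hx2 : x ∈ maximalIdeal R ^ 2
    · exact Set.mem_biUnion (by simp [T]) hx2
    · have : x ∈ ⋃ p ∈ associatedPrimes R R, (p : Set R) := by
        rw [biUnion_associatedPrimes_eq_compl_regular]
        exact hcon x hx hx2
      obtain ⟨p, hp, hxp⟩ := Set.mem_iUnion₂.1 this
      exact Set.mem_biUnion (by simp [T, hp]) hxp
  obtain ⟨I, hI, hle⟩ := (Ideal.subset_union_prime (maximalIdeal R ^ 2) (maximalIdeal R ^ 2) (by
    intro p hp hne _
    have : p ∈ associatedPrimes R R := by simpa [T, hne] using hp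
    exact this.isPrime)).1 hsub
  rcases Finset.mem_insert.1 hI with rfl | hI
  · have : maximalIdeal R = ⊥ := by
      refine Submodule.eq_bot_of_le_smul_of_le_jacobson_bot (maximalIdeal R) (maximalIdeal R)
        (maximalIdeal R).fg_of_isNoetherianRing ?_ (maximalIdeal_le_jacobson _)
      exact (hle.trans_eq (pow_two _) :)
    obtain ⟨y, hy, hy0⟩ := h 1 one_ne_zero
    exact hy0 (by rw [this] at hy; simpa using hy)
  · have hI : I ∈ associatedPrimes R R := by simpa using hI
    obtain ⟨hp, s, rfl⟩ := isAssociatedPrime_iff.1 hI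
    obtain ⟨y, hy, hy0⟩ := h s (by rintro rfl; exact hp.ne_top (by simp))
    have : y ∈ (⊥ : Submodule R R).colon {s} := hle hy
    rw [Submodule.mem_colon_singleton, Submodule.mem_bot, smul_eq_mul, mul_comm] at this
    exact hy0 this

/-- For `x` a minimal generator of the maximal ideal `m`, the residue field of `R ⧸ (x)` is a
retract of `m ⧸ x m`. -/
lemma nonempty_retract_residueField [IsLocalRing R] {x : R} (hx : x ∈ maximalIdeal R)
    (hx2 : x ∉ maximalIdeal R ^ 2) [IsLocalRing (R ⧸ Ideal.span {x})] :
    Nonempty (Retract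
      (ModuleCat.of (R ⧸ Ideal.span {x}) (ResidueField (R ⧸ Ideal.span {x})))
      (ModuleCat.of (R ⧸ Ideal.span {x}) (QuotSMulTop x (maximalIdeal R)))) := by
  have hR' : Function.Surjective (algebraMap R (R ⧸ Ideal.span {x})) :=
    Ideal.Quotient.mk_surjective
  let k' := ResidueField (R ⧸ Ideal.span {x})
  let ξ : maximalIdeal R := ⟨x, hx⟩
  have : IsLocalHom (algebraMap R (R ⧸ Ideal.span {x})) := .of_surjective _ hR'
  have hm {y : R} : algebraMap R (R ⧸ Ideal.span {x}) y ∈ maximalIdeal (R ⧸ Ideal.span {x}) ↔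
      y ∈ maximalIdeal R := by
    simp only [mem_maximalIdeal, mem_nonunits_iff, isUnit_map_iff]
  let ι : k' →ₗ[R ⧸ Ideal.span {x}] QuotSMulTop x (maximalIdeal R) :=
    Submodule.liftQ (maximalIdeal (R ⧸ Ideal.span {x}))
      (LinearMap.toSpanSingleton _ _ (Submodule.Quotient.mk ξ)) <| by
    intro y hy
    obtain ⟨y, rfl⟩ := hR' y
    change Submodule.Quotient.mk (y • ξ) = 0
    rw [Submodule.Quotient.mk_eq_zero]
    exact ⟨⟨y, hm.1 hy⟩, trivial, Subtype.ext (mul_comm _ _)⟩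
  have hξ : (maximalIdeal R).toCotangent ξ ≠ 0 := by
    rwa [Ne, Ideal.toCotangent_eq_zero]
  obtain ⟨φ, hφ⟩ := Module.Projective.exists_dual_eq_one (ResidueField R) hξ
  let q : ResidueField R →ₗ[R] k' :=
    Submodule.liftQ (maximalIdeal R) (Algebra.linearMap R k') fun y hy ↦
      (Ideal.Quotient.eq_zero_iff_mem).2 (hm.2 hy)
  let ρ₀ : maximalIdeal R →ₗ[R] k' :=
    q ∘ₗ φ.restrictScalars R ∘ₗ (maximalIdeal R).toCotangent
  let ρ : QuotSMulTop x (maximalIdeal R) →ₗ[R ⧸ Ideal.span {x}] k' :=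
    (Submodule.liftQ _ ρ₀ (by
      rintro _ ⟨y, -, rfl⟩
      have : x • ρ₀ y = 0 := by
        rw [← algebraMap_smul (R ⧸ Ideal.span {x})]
        have : algebraMap R (R ⧸ Ideal.span {x}) x = 0 :=
          Ideal.Quotient.eq_zero_iff_mem.2 (Ideal.mem_span_singleton_self x)
        rw [this, zero_smul]
      exact (ρ₀.map_smul x y).trans this)).extendScalarsOfSurjective hR'
  refine ⟨⟨ModuleCat.ofHom ι, ModuleCat.ofHom ρ, ?_⟩⟩
  have h1 : ρ (ι 1) = 1 := by
    have : ι 1 = Submodule.Quotient.mk ξ := by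
      change (1 : R ⧸ Ideal.span {x}) • (Submodule.Quotient.mk ξ : QuotSMulTop x _) = _
      exact one_smul _ _
    rw [this]
    change q (φ ((maximalIdeal R).toCotangent ξ)) = 1
    rw [hφ]
    rfl
  have h2 : ρ ∘ₗ ι = LinearMap.id := by
    refine LinearMap.ext fun z ↦ ?_
    obtain ⟨r, rfl⟩ := residue_surjective z
    have hr : residue (R ⧸ Ideal.span {x}) r = r • (1 : k') := by
      rw [Algebra.smul_def, mul_one]; rfl
    rw [hr, map_smul, LinearMap.comp_apply, h1, LinearMap.id_apply]
  exact ModuleCat.hom_ext h2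

lemma spanFinrank_maximalIdeal_le_quotient_add_one [IsLocalRing R] [IsNoetherianRing R] (x : R)
    [IsLocalRing (R ⧸ Ideal.span {x})] :
    (maximalIdeal R).spanFinrank ≤ (maximalIdeal (R ⧸ Ideal.span {x})).spanFinrank + 1 := by
  classical
  have hsurj : Function.Surjective (Ideal.Quotient.mk (Ideal.span {x})) :=
    Ideal.Quotient.mk_surjective
  have : IsLocalHom (Ideal.Quotient.mk (Ideal.span {x})) := .of_surjective _ hsurj
  obtain ⟨s, hs, hspan⟩ := Submodule.FG.exists_span_finset_card_eq_spanFinrank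
    (maximalIdeal (R ⧸ Ideal.span {x})).fg_of_isNoetherianRing
  let t : Finset R := insert x (s.image (Function.surjInv hsurj))
  have ht : Ideal.span (t : Set R) = maximalIdeal R := by
    have hmap : (Ideal.span (Function.surjInv hsurj '' s)).map (Ideal.Quotient.mk _) =
        maximalIdeal (R ⧸ Ideal.span {x}) := by
      rw [Ideal.map_span, ← Set.image_comp, (Function.rightInverse_surjInv hsurj).comp_eq_id,
        Set.image_id]
      exact hspan
    rw [← (((local_hom_TFAE (Ideal.Quotient.mk (Ideal.span {x}))).out 0 4).1 ‹_› :), ← hmap,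
      Ideal.comap_map_of_surjective _ hsurj, ← RingHom.ker_eq_comap_bot, Ideal.mk_ker, sup_comm,
      ← Ideal.span_union]
    simp [t]
  rw [← ht, ← hs]
  calc _ ≤ (t : Set R).ncard := Submodule.spanFinrank_span_le_ncard_of_finite t.finite_toSet
    _ ≤ _ := by
      rw [Set.ncard_coe_finset]
      exact (Finset.card_insert_le _ _).trans (Nat.add_le_add_right Finset.card_image_le _)

lemma maximalIdeal_eq_bot_of_free_residueField [IsLocalRing R]
    [Module.Free R (ResidueField R)] : maximalIdeal R = ⊥ := by
  let b := Module.Free.chooseBasis R (ResidueField R)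
  obtain ⟨i⟩ := b.index_nonempty
  refine eq_bot_iff.2 fun y hy ↦ ?_
  have h0 : y • b i = 0 := by
    rw [Algebra.smul_def, ResidueField.algebraMap_eq, (residue_eq_zero_iff y).2 hy, zero_mul]
  simpa using congrArg (fun w ↦ b.repr w i) h0

/-- Serre's theorem: a noetherian local ring whose residue field has finite projective dimension
is regular. -/
theorem isRegularLocalRing_of_hasProjectiveDimensionLT [IsLocalRing R] [IsNoetherianRing R] {n : ℕ}
    (h : HasProjectiveDimensionLT (ModuleCat.of R (ResidueField R)) n) :
    IsRegularLocalRing R := by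
  obtain ⟨d, hd⟩ : ∃ d : ℕ, ringKrullDim R < d := by
    refine ⟨(maximalIdeal R).spanFinrank + 1,
      (ringKrullDim_le_spanFinrank_maximalIdeal R).trans_lt ?_⟩
    exact_mod_cast Nat.lt_succ_self (maximalIdeal R).spanFinrank
  induction d generalizing R n with
  | zero => exact absurd ringKrullDim_nonneg_of_nontrivial hd.not_ge
  | succ d ih =>
    by_cases hs : ∃ s : R, s ≠ 0 ∧ ∀ y ∈ maximalIdeal R, s * y = 0
    · obtain ⟨s, hs, hsm⟩ := hs
      have := free_of_hasProjectiveDimensionLT hs hsm h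
      refine .of_spanFinrank_maximalIdeal_le R ?_
      rw [maximalIdeal_eq_bot_of_free_residueField, Submodule.spanFinrank_bot]
      exact ringKrullDim_nonneg_of_nontrivial
    · push Not at hs
      obtain ⟨x, hx, hx2, hreg⟩ := exists_isSMulRegular_of_forall_exists_mul_ne_zero hs
      have hne : Ideal.span {x} ≠ ⊤ := by
        rwa [Ne, Ideal.span_singleton_eq_top]
      have : Nontrivial (R ⧸ Ideal.span {x}) := Ideal.Quotient.nontrivial_iff.2 hne
      have : IsLocalRing (R ⧸ Ideal.span {x}) :=
        .of_surjective' _ Ideal.Quotient.mk_surjective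
      have hpd : HasProjectiveDimensionLT (ModuleCat.of R (maximalIdeal R)) (n + 1) := by
        have h' : HasProjectiveDimensionLT (ModuleCat.of R (ResidueField R)) (n + 2) :=
          hasProjectiveDimensionLT_of_ge _ n _ (by lia)
        have hsurj : Function.Surjective (Algebra.linearMap R (ResidueField R)) :=
          residue_surjective
        have hker : LinearMap.ker (Algebra.linearMap R (ResidueField R)) = maximalIdeal R :=
          ker_residue
        have := LinearMap.hasProjectiveDimensionLT_ker hsurj h'
        rwa [hker] at this
      obtain ⟨r⟩ := nonempty_retract_residueField hx hx2
      have := hasProjectiveDimensionLT_quotSMulTop hreg (hreg.submodule _ _) hpd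
      have hdim := ringKrullDim_quotient_span_singleton_succ_eq_ringKrullDim hreg hx
      have hd' : ringKrullDim (R ⧸ Ideal.span {x}) < d := by
        rw [← hdim, Nat.cast_succ] at hd
        exact lt_of_add_lt_add_right hd
      have hR' := ih (R := R ⧸ Ideal.span {x}) (n := n + 1) (r.hasProjectiveDimensionLT _) hd'
      refine .of_spanFinrank_maximalIdeal_le R ?_
      rw [← hdim, ← IsRegularLocalRing.spanFinrank_maximalIdeal]
      exact_mod_cast spanFinrank_maximalIdeal_le_quotient_add_one x

lemma IsRegularLocalRing.isRegularLocal {R : Type} [CommRing R] [IsRegularLocalRing R] :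
    IsRegularLocal R := by
  obtain ⟨s, hs, hspan⟩ := Submodule.FG.exists_span_finset_card_eq_spanFinrank
    (maximalIdeal R).fg_of_isNoetherianRing
  refine ⟨s, hspan, ?_⟩
  rw [hs]
  exact IsRegularLocalRing.spanFinrank_maximalIdeal

end Serre

/-- Dey's theorem: if `t = depth R ≥ 3` and `(Ωⁱ k)* ≅ Ωⁱ k` for some `2 ≤ i < t`,
then `R` is regular and `t = 2i - 1`. -/
theorem stmt_16 (R : Type) [CommRing R] [IsLocalRing R] [IsNoetherianRing R]
    (t : ℕ) (ht : localDepth R R = t) (h3 : 3 ≤ t)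
    (i : ℕ) (h2 : 2 ≤ i) (hit : i < t)
    (C : MinFreeRes R (ResidueField R))
    (hiso : Nonempty (Module.Dual R (C.Syz i) ≃ₗ[R] C.Syz i)) :
    IsRegularLocal R ∧ t = 2 * i - 1 := by
  obtain ⟨n, rfl⟩ := Nat.exists_eq_add_of_le' h2
  have hlt (p : ℕ) (hp : p < t) : C.DualExactAt p := by
    rw [← C.subsingleton_extMod_iff, ← not_nontrivial_iff_subsingleton]
    exact Nat.notMem_of_lt_sInf (s := {i | Nontrivial (ExtMod R (ResidueField R) R i)})
      (hp.trans_eq ht.symm)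
  have htop : ¬ C.DualExactAt t := by
    rw [← C.subsingleton_extMod_iff, not_subsingleton_iff_nontrivial, ← ht]
    refine Nat.sInf_mem (s := {i | Nontrivial (ExtMod R (ResidueField R) R i)})
      (Nat.nonempty_of_pos_sInf ?_)
    change 0 < localDepth R R
    lia
  obtain ⟨e⟩ := hiso
  obtain ⟨e'⟩ := MinFreeRes.nonempty_dual_syz_equiv (hlt (n + 2) hit)
  have e'' := e.symm.trans e'
  have := C.hasProjectiveDimensionLT_of_syz_equiv (fun p hp ↦ hlt p (by lia)) e''
  exact ⟨(isRegularLocalRing_of_hasProjectiveDimensionLT this).isRegularLocal,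
    by have := C.eq_of_dual_syz_equiv hit hlt htop e''; lia⟩
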